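/- (Absorption) For all 1 ≤ n < m, the extremal weight projector absorbs lower-order projectors: t_m ∘ (t_n ⊗ id^{⊗(m−n)}) = (t_n ⊗ id^{⊗(m−n)}) ∘ t_m = t_m in End(V^{⊗m}). -/

import Mathlib

open Matrix

noncomputable section

/-- Sign strings `ε ∈ {+,-}^m`; `true` encodes `+` and `false` encodes `-`. -/
abbrev Sgn (m : ℕ) := Fin m → Bool

/-- Endomorphisms of `V^{⊗m}` (`V = ℂ²`), as matrices indexed by sign strings. -/
abbrev Op (m : ℕ) := Matrix (Sgn m) (Sgn m) ℂ

/-- Linear maps `V^{⊗m} → V^{⊗n}`, as matrices (rows: target, columns: source). -/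
abbrev Mor (m n : ℕ) := Matrix (Sgn n) (Sgn m) ℂ

/-- The basis vector `v_ε` of `V^{⊗m}`. -/
def bv {m : ℕ} (ε : Sgn m) : Sgn m → ℂ := fun δ => if δ = ε then 1 else 0

/-- The coefficient of `cap` on `v_a ⊗ v_b`:
`cap (v₋ ⊗ v₊) = 1`, `cap (v₊ ⊗ v₋) = -1`, `cap (v₊ ⊗ v₊) = cap (v₋ ⊗ v₋) = 0`. -/
def capc (a b : Bool) : ℂ := if a then (if b then 0 else -1) else (if b then 1 else 0)

/-- The coefficient of `v_a ⊗ v_b` in `cup 1 = v₊ ⊗ v₋ - v₋ ⊗ v₊`. -/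
def cupc (a b : Bool) : ℂ := if a then (if b then 0 else 1) else (if b then -1 else 0)

/-- The cap `V ⊗ V → ℂ`. -/
def capM : Mor 2 0 := Matrix.of fun _ ε => capc (ε 0) (ε 1)

/-- The cup `ℂ → V ⊗ V`. -/
def cupM : Mor 0 2 := Matrix.of fun δ _ => cupc (δ 0) (δ 1)

/-- The tensor product of two linear maps. -/
def tensMor {a b c d : ℕ} (A : Mor a b) (B : Mor c d) : Mor (a + c) (b + d) :=
  Matrix.of fun δ ε =>
    A (fun i => δ (Fin.castAdd d i)) (fun i => ε (Fin.castAdd c i)) *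
      B (fun j => δ (Fin.natAdd b j)) (fun j => ε (Fin.natAdd a j))

/-- The swap of the two tensor factors of `V ⊗ V`. -/
def swap2 : Op 2 := Matrix.of fun δ ε => if δ 0 = ε 1 ∧ δ 1 = ε 0 then 1 else 0

/-- `id^{⊗p} ⊗ A ⊗ id^{⊗(m-p-2)}`: the operator `A` on two strands placed at the
(0-based) positions `p`, `p+1` among `m` strands. -/
def atPos (m p : ℕ) (A : Op 2) : Op m :=
  Matrix.of fun δ ε =>
    if h : p + 2 ≤ m then
      (if ∀ k : Fin m, k.val ≠ p → k.val ≠ p + 1 → δ k = ε k then 1 else 0) *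
        A (fun i => δ ⟨p + i.val, Nat.lt_of_lt_of_le (Nat.add_lt_add_left i.isLt p) h⟩)
          (fun i => ε ⟨p + i.val, Nat.lt_of_lt_of_le (Nat.add_lt_add_left i.isLt p) h⟩)
    else 0

/-- Cyclic rotation of sign strings: `(rotIdx δ) k = δ (k+1 mod m)`. -/
def rotIdx {m : ℕ} (δ : Sgn m) : Sgn m := fun k => δ ⟨(k.val + 1) % m, Nat.mod_lt _ k.pos⟩

/-- The rotation `d_m : V^{⊗m} → V^{⊗m}`, `d_m (v_ε ⊗ w) = i^{ε} (w ⊗ v_ε)`. -/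
def dRot : (m : ℕ) → Op m
  | 0 => 1
  | (m + 1) =>
    Matrix.of fun δ' δ =>
      if δ' = rotIdx δ then (if δ 0 then Complex.I else -Complex.I) else 0

/-- The cap-cup generator `u_j` (`j` is 1-based, `1 ≤ j ≤ m-1`);
`u_0 := d_m⁻¹ ∘ u_1 ∘ d_m` is the affine generator. -/
def uFull (m j : ℕ) : Op m :=
  if j = 0 then (dRot m)⁻¹ * atPos m 0 (cupM * capM) * dRot m
  else atPos m (j - 1) (cupM * capM)

/-- The extremal weight projectors `t_m`, defined by `t₁ = id`,
`t₂ = id + u₁/2 + u₀/2`, and `t_{m+1} = (t_m ⊗ id) ∘ σ_m ∘ (t_m ⊗ id)` for `m ≥ 2`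
(with the convention `t₀ = 2·id`). -/
def tP : (m : ℕ) → Op m
  | 0 => (2 : ℂ) • 1
  | 1 => 1
  | 2 => 1 + (2⁻¹ : ℂ) • atPos 2 0 (cupM * capM) +
      (2⁻¹ : ℂ) • ((dRot 2)⁻¹ * atPos 2 0 (cupM * capM) * dRot 2)
  | (m + 3) =>
    tensMor (tP (m + 2)) (1 : Op 1) * atPos (m + 3) (m + 1) swap2 *
      tensMor (tP (m + 2)) (1 : Op 1)

/-- `n` nested caps `Ca_n : V^{⊗2n} → ℂ`. -/
def CaM (n : ℕ) : Mor (n + n) 0 :=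
  Matrix.of fun _ δ =>
    ∏ k : Fin n,
      capc (δ ⟨k.val, Nat.lt_of_lt_of_le k.isLt (Nat.le_add_right n n)⟩)
        (δ ⟨n + n - 1 - k.val,
          Nat.lt_of_le_of_lt (Nat.sub_le _ _)
            (Nat.sub_lt (Nat.lt_of_lt_of_le k.pos (Nat.le_add_right n n)) Nat.one_pos)⟩)

/-- `n` nested cups `Cu_n : ℂ → V^{⊗2n}`. -/
def CuM (n : ℕ) : Mor 0 (n + n) :=
  Matrix.of fun δ _ =>
    ∏ k : Fin n,
      cupc (δ ⟨k.val, Nat.lt_of_lt_of_le k.isLt (Nat.le_add_right n n)⟩)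
        (δ ⟨n + n - 1 - k.val,
          Nat.lt_of_le_of_lt (Nat.sub_le _ _)
            (Nat.sub_lt (Nat.lt_of_lt_of_le k.pos (Nat.le_add_right n n)) Nat.one_pos)⟩)

/-- The canonical identification of sign strings induced by an equality of lengths. -/
def sgnCast {a b : ℕ} (h : a = b) : Sgn a ≃ Sgn b :=
  Equiv.arrowCongr (finCongr h) (Equiv.refl Bool)

/-- Reindexing of a linear map along equalities of the numbers of strands. -/
def rc {a b c d : ℕ} (h1 : a = b) (h2 : c = d) (A : Mor a c) : Mor b d :=
  Matrix.reindex (sgnCast h2) (sgnCast h1) A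

/-- The idempotents `e_{m,n}`:
`e_{1,1} = -u₁/2 - d₂⁻¹ ∘ u₁ ∘ d₂ / 2` and
`e_{m,n} = -(t_m ⊗ t_n) ∘ u_m ∘ (t_m ⊗ t_n)` otherwise. -/
def eP : (m n : ℕ) → Op (m + n)
  | 1, 1 =>
    (-(2⁻¹ : ℂ)) • atPos 2 0 (cupM * capM) +
      (-(2⁻¹ : ℂ)) • ((dRot 2)⁻¹ * atPos 2 0 (cupM * capM) * dRot 2)
  | m, n =>
    -(tensMor (tP m) (tP n) * atPos (m + n) (m - 1) (cupM * capM) * tensMor (tP m) (tP n))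

/-- The sign string `ε` is constant. -/
def IsConst {m : ℕ} (ε : Sgn m) : Prop := ∀ i j, ε i = ε j

open Classical in
/-- The diagonal projection of `V^{⊗m}` onto the span of the `v_ε` with `ε` constant. -/
def constProj (m : ℕ) : Op m := Matrix.diagonal fun ε => if IsConst ε then 1 else 0

theorem tensMor_diagonal_one {n k : ℕ} (f : Sgn n → ℂ) :
    tensMor (Matrix.diagonal f) (1 : Op k) =
      Matrix.diagonal fun ε : Sgn (n + k) => f fun i => ε (Fin.castAdd k i) := by
  ext δ ε
  simp only [tensMor, Matrix.of_apply, Matrix.diagonal_apply, Matrix.one_apply]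
  by_cases h : δ = ε
  · subst h; simp
  · rw [if_neg h]
    by_cases h1 : (fun i => δ (Fin.castAdd k i)) = fun i => ε (Fin.castAdd k i)
    · have h2 : (fun j => δ (Fin.natAdd n j)) ≠ fun j => ε (Fin.natAdd n j) := by
        intro h2
        refine h (funext fun x => ?_)
        induction x using Fin.addCases with
        | left i => exact congrFun h1 i
        | right j => exact congrFun h2 j
      simp [h2]
    · simp [h1]

theorem sum_sgn_two (f : Sgn 2 → ℂ) :
    ∑ ε, f ε = f ![true, true] + f ![true, false] + f ![false, true] + f ![false, false] := by
  rw [← (finTwoArrowEquiv Bool).symm.sum_comp, Fintype.sum_prod_type]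
  simp [finTwoArrowEquiv, add_assoc]

theorem sgn_two_cases (δ : Sgn 2) :
    δ = ![true, true] ∨ δ = ![true, false] ∨ δ = ![false, true] ∨ δ = ![false, false] := by
  revert δ; decide

theorem rotIdx_two (a b : Bool) : rotIdx ![a, b] = ![b, a] := by
  ext k; fin_cases k <;> rfl

theorem inv_dRot_two : (dRot 2)⁻¹ = (dRot 2)ᴴ := by
  refine Matrix.inv_eq_right_inv ?_
  ext δ ε
  rw [Matrix.mul_apply, sum_sgn_two]
  rcases sgn_two_cases δ with rfl | rfl | rfl | rfl <;>
    rcases sgn_two_cases ε with rfl | rfl | rfl | rfl <;>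
    simp [dRot, rotIdx_two]

theorem atPos_two_zero (A : Op 2) : atPos 2 0 A = A := by
  ext δ ε
  have h : ∀ k : Fin 2, k.val ≠ 0 → k.val ≠ 0 + 1 → δ k = ε k := by
    intro k h0 h1; omega
  simp only [atPos, Matrix.of_apply, dif_pos (show 0 + 2 ≤ 2 by norm_num), if_pos h, one_mul]
  congr 1 <;> (ext i; simp)

theorem tP_two : tP 2 = constProj 2 := by
  rw [tP, inv_dRot_two, atPos_two_zero]
  ext δ ε
  simp only [Matrix.add_apply, Matrix.smul_apply, Matrix.mul_apply, sum_sgn_two, constProj,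
    Matrix.diagonal_apply, IsConst, Fin.forall_fin_two]
  rcases sgn_two_cases δ with rfl | rfl | rfl | rfl <;>
    rcases sgn_two_cases ε with rfl | rfl | rfl | rfl <;>
    simp [dRot, rotIdx_two, cupM, capM, cupc, capc] <;> norm_num

theorem constProj_step (m : ℕ) :
    tensMor (constProj (m + 2)) (1 : Op 1) * atPos (m + 3) (m + 1) swap2 *
      tensMor (constProj (m + 2)) (1 : Op 1) = constProj (m + 3) := by
  classical
  rw [constProj, tensMor_diagonal_one, constProj]
  ext δ ε
  rw [Matrix.mul_diagonal, Matrix.diagonal_mul, Matrix.diagonal_apply]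
  by_cases hδ : IsConst fun i => δ (Fin.castAdd 1 i)
  swap
  · have h : ¬ IsConst δ := fun h => hδ fun i j => h _ _
    simp [hδ, h]
  by_cases hε : IsConst fun i => ε (Fin.castAdd 1 i)
  swap
  · have h : ¬ IsConst ε := fun h => hε fun i j => h _ _
    by_cases e : δ = ε
    · subst e; exact absurd hδ hε
    · simp [hε, e]
  rw [if_pos hδ, if_pos hε, one_mul, mul_one]
  simp only [atPos, Matrix.of_apply, dif_pos (show m + 1 + 2 ≤ m + 3 by omega), swap2]
  have key : δ = ε ∧ IsConst δ ↔
      (∀ k : Fin (m + 3), k.val ≠ m + 1 → k.val ≠ m + 1 + 1 → δ k = ε k) ∧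
        δ ⟨m + 1, by omega⟩ = ε ⟨m + 2, by omega⟩ ∧
        δ ⟨m + 2, by omega⟩ = ε ⟨m + 1, by omega⟩ := by
    constructor
    · rintro ⟨rfl, h⟩
      exact ⟨fun _ _ _ => rfl, h _ _, h _ _⟩
    · rintro ⟨h0, h1, h2⟩
      have hd (k : Fin (m + 3)) (hk : k.val < m + 2) : δ k = δ 0 := hδ ⟨k, hk⟩ 0
      have he (k : Fin (m + 3)) (hk : k.val < m + 2) : ε k = ε 0 := hε ⟨k, hk⟩ 0
      have h00 : δ 0 = ε 0 := h0 0 (by simp) (by simp)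
      have hδ0 (k : Fin (m + 3)) : δ k = δ 0 := by
        by_cases hk : k.val < m + 2
        · exact hd k hk
        · rw [show k = ⟨m + 2, by omega⟩ from Fin.ext (by simp; omega), h2, he _ (by simp), h00]
      have hε0 (k : Fin (m + 3)) : ε k = ε 0 := by
        by_cases hk : k.val < m + 2
        · exact he k hk
        · rw [show k = ⟨m + 2, by omega⟩ from Fin.ext (by simp; omega), ← h1, hd _ (by simp), h00]
      exact ⟨funext fun k => by rw [hδ0, hε0, h00], fun i j => by rw [hδ0, hδ0 j]⟩
  rw [← ite_and, if_congr key rfl rfl]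
  simp only [ite_and, ite_mul, one_mul, zero_mul]
  rfl

theorem tP_succ (m : ℕ) : tP (m + 1) = constProj (m + 1) := by
  induction m with
  | zero =>
    ext δ ε
    have h (δ : Sgn 1) : IsConst δ := fun i j => congrArg δ (Subsingleton.elim i j)
    simp [tP, constProj, h]
  | succ m ih =>
    cases m with
    | zero => exact tP_two
    | succ m => rw [tP, ih, constProj_step]

/-- Absorption: for `1 ≤ n < m` (here `m = n + k` with `k ≥ 1`),
`t_m ∘ (t_n ⊗ id^{⊗(m-n)}) = (t_n ⊗ id^{⊗(m-n)}) ∘ t_m = t_m`. -/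
theorem tP_absorption (n k : ℕ) (hn : 1 ≤ n) (hk : 1 ≤ k) :
    tP (n + k) * tensMor (tP n) (1 : Op k) = tP (n + k) ∧
    tensMor (tP n) (1 : Op k) * tP (n + k) = tP (n + k) := by
  obtain ⟨n, rfl⟩ := Nat.exists_eq_succ_of_ne_zero (Nat.one_le_iff_ne_zero.mp hn)
  have e : n.succ + k = (n + k) + 1 := by omega
  have h : tP (n.succ + k) = constProj (n.succ + k) := by rw [e, tP_succ]
  have hc (ε : Sgn (n.succ + k)) (hε : IsConst ε) :
      IsConst fun i => ε (Fin.castAdd k i) := fun i j => hε _ _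
  rw [h, tP_succ, constProj, constProj, tensMor_diagonal_one, Matrix.diagonal_mul_diagonal,
    Matrix.diagonal_mul_diagonal]
  constructor <;>
  · congr 1
    ext ε
    by_cases hε : IsConst ε
    · simp [hε, hc ε hε]
    · simp [hε]
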